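/- Let f : ℕ → ℕ have controlled growth, fix k ≥ 1, let O = (v_n, n ≥ 1) be an activator sequence on G(f) with v_i ≠ ∅ for some i > k, and let T = (u_n, n ≥ 1) be the trimmed activator sequence with u_1 = ⋯ = u_k = ∅ and u_i = v_i for all i > k. Then δ̲(G(f),T) = δ̲(G(f),O) and δ̄(G(f),T) = δ̄(G(f),O). -/

import Mathlib

open Filter Asymptotics

/-- Membership in the grid `[-f n, f n]^2 ⊆ ℤ × ℤ`. -/
def inGrid (f : ℕ → ℕ) (n : ℕ) (p : ℤ × ℤ) : Prop :=
  |p.1| ≤ (f n : ℤ) ∧ |p.2| ≤ (f n : ℤ)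

instance (f : ℕ → ℕ) (n : ℕ) : DecidablePred (inGrid f n) := fun _ => by
  unfold inGrid; infer_instance

/-- The four lattice neighbours (at `L¹`-distance one) of a point. -/
def nbrs (p : ℤ × ℤ) : Finset (ℤ × ℤ) :=
  {(p.1 + 1, p.2), (p.1 - 1, p.2), (p.1, p.2 + 1), (p.1, p.2 - 1)}

/-- An activator sequence: whenever `V n ≠ ∅` (for `n ≥ 1`), the activated vertex
lies in the grid at time `n`. -/
def IsActivator (f : ℕ → ℕ) (V : ℕ → Option (ℤ × ℤ)) : Prop :=
  ∀ n, 1 ≤ n → ∀ p, V n = some p → inGrid f n p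

/-- The burning process: `B 0 = ∅`, and `B n` is obtained from `B (n-1)` by adding all
vertices of the grid at time `n` adjacent to a vertex of `B (n-1)`, and then adding
the activator `V n` if it is not `∅`. -/
def burnSet (f : ℕ → ℕ) (V : ℕ → Option (ℤ × ℤ)) : ℕ → Finset (ℤ × ℤ)
  | 0 => ∅
  | n + 1 =>
    let B := burnSet f V n
    let spread := B ∪ (B.biUnion nbrs).filter (inGrid f (n + 1))
    match V (n + 1) with
    | none => spread
    | some v => insert v spread

/-- The proportion `|B n| / |V(G n)|` of burning vertices at time `n`. -/
noncomputable def densitySeq (f : ℕ → ℕ) (V : ℕ → Option (ℤ × ℤ)) (n : ℕ) : ℝ :=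
  ((burnSet f V n).card : ℝ) / (2 * (f n : ℝ) + 1) ^ 2

/-- The lower burning density `δ̲(G(f), V)`. -/
noncomputable def lowerDensity (f : ℕ → ℕ) (V : ℕ → Option (ℤ × ℤ)) : ℝ :=
  liminf (densitySeq f V) atTop

/-- The upper burning density `δ̄(G(f), V)`. -/
noncomputable def upperDensity (f : ℕ → ℕ) (V : ℕ → Option (ℤ × ℤ)) : ℝ :=
  limsup (densitySeq f V) atTop

/-- The burning density of `V` in `G(f)` exists and equals `ρ`. -/
def HasBurningDensity (f : ℕ → ℕ) (V : ℕ → Option (ℤ × ℤ)) (ρ : ℝ) : Prop :=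
  Tendsto (densitySeq f V) atTop (nhds ρ)

/-- `P(G(f))`: the set of `ρ ∈ [0,1]` achievable as the burning density of some
non-empty activator sequence. -/
def densSet (f : ℕ → ℕ) : Set ℝ :=
  {ρ | ρ ∈ Set.Icc (0 : ℝ) 1 ∧
    ∃ V : ℕ → Option (ℤ × ℤ), IsActivator f V ∧ (∃ t, 1 ≤ t ∧ V t ≠ none) ∧
      HasBurningDensity f V ρ}

/-- The controlled growth requirement. -/
def ControlledGrowth (f : ℕ → ℕ) : Prop :=
  (∀ᶠ n in atTop, f n < f (n + 1)) ∧
  (∀ ε : ℕ → ℕ, (fun n => (ε n : ℝ)) =o[atTop] (fun n => (n : ℝ)) →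
    Tendsto (fun n => (f (n + ε n) : ℝ) / (f n : ℝ)) atTop (nhds 1)) ∧
  (∀ c : ℝ, 0 < c → ∃ d : ℝ, 0 < d ∧
    ∀ᶠ n in atTop, (1 + d) * (f n : ℝ) ≤ (f (n + ⌈c * n⌉₊) : ℝ))

lemma burnSet_succ_subset (f : ℕ → ℕ) (V : ℕ → Option (ℤ × ℤ)) (n : ℕ) :
    burnSet f V n ⊆ burnSet f V (n + 1) := by
  intro p hp
  simp only [burnSet]
  cases V (n + 1) <;> simp [hp]

lemma burnSet_mono (f : ℕ → ℕ) (V : ℕ → Option (ℤ × ℤ)) : Monotone (burnSet f V) :=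
  monotone_nat_of_le_succ (burnSet_succ_subset f V)

lemma mem_burnSet_succ {f : ℕ → ℕ} {V : ℕ → Option (ℤ × ℤ)} {n : ℕ} {p : ℤ × ℤ} :
    p ∈ burnSet f V (n + 1) ↔
      V (n + 1) = some p ∨ p ∈ burnSet f V n ∨
        (∃ q ∈ burnSet f V n, p ∈ nbrs q) ∧ inGrid f (n + 1) p := by
  simp only [burnSet]
  cases V (n + 1) <;> simp [eq_comm]

lemma inGrid_of_le {f : ℕ → ℕ} {m n : ℕ} (h : f m ≤ f n) {p : ℤ × ℤ} (hp : inGrid f m p) :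
    inGrid f n p := by
  unfold inGrid at *
  omega

lemma eventually_inGrid {f : ℕ → ℕ} (hf : Tendsto f atTop atTop) (p : ℤ × ℤ) :
    ∀ᶠ n in atTop, inGrid f n p := by
  filter_upwards [hf.eventually_ge_atTop (p.1.natAbs + p.2.natAbs)] with n hn
  constructor <;> rw [abs_le] <;> omega

/-- Once the grids exhaust the plane, a burning vertex eventually ignites its neighbours. -/
lemma exists_mem_burnSet_of_mem_nbrs {f : ℕ → ℕ} (hf : Tendsto f atTop atTop)
    {V : ℕ → Option (ℤ × ℤ)} {p q : ℤ × ℤ} (hq : q ∈ nbrs p)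
    (hp : ∃ m, p ∈ burnSet f V m) : ∃ m, q ∈ burnSet f V m := by
  obtain ⟨m, hm⟩ := hp
  obtain ⟨N, hN⟩ := eventually_atTop.1 (eventually_inGrid hf q)
  exact ⟨max m N + 1, mem_burnSet_succ.2 <| Or.inr <| Or.inr
    ⟨⟨p, burnSet_mono f V (le_max_left m N) hm, hq⟩, hN _ (by omega)⟩⟩

/-- Once the grids exhaust the plane, a single burning vertex eventually ignites every vertex. -/
lemma exists_mem_burnSet {f : ℕ → ℕ} (hf : Tendsto f atTop atTop)
    {V : ℕ → Option (ℤ × ℤ)} {p : ℤ × ℤ} (hp : ∃ m, p ∈ burnSet f V m) (q : ℤ × ℤ) :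
    ∃ m, q ∈ burnSet f V m := by
  have horizontal : ∀ x : ℤ, ∃ m, (x, p.2) ∈ burnSet f V m := fun x => by
    induction x using Int.inductionOn' with
    | b => exact p.1
    | zero => exact hp
    | succ a _ ih => exact exists_mem_burnSet_of_mem_nbrs hf (by simp [nbrs]) ih
    | pred a _ ih => exact exists_mem_burnSet_of_mem_nbrs hf (by simp [nbrs]) ih
  obtain ⟨x, y⟩ := q
  induction y using Int.inductionOn' with
  | b => exact p.2
  | zero => exact horizontal x
  | succ a _ ih => exact exists_mem_burnSet_of_mem_nbrs hf (by simp [nbrs]) ih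
  | pred a _ ih => exact exists_mem_burnSet_of_mem_nbrs hf (by simp [nbrs]) ih

lemma exists_subset_burnSet {f : ℕ → ℕ} (hf : Tendsto f atTop atTop)
    {V : ℕ → Option (ℤ × ℤ)} {p : ℤ × ℤ} (hp : ∃ m, p ∈ burnSet f V m)
    (S : Finset (ℤ × ℤ)) : ∃ m, S ⊆ burnSet f V m := by
  choose m hm using exists_mem_burnSet hf hp
  exact ⟨S.sup m, fun q hq => burnSet_mono f V (Finset.le_sup hq) (hm q)⟩

/-- Pointwise larger activator sequences burn pointwise larger sets. -/
lemma burnSet_subset_of_forall {f : ℕ → ℕ} {T O : ℕ → Option (ℤ × ℤ)}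
    (h : ∀ n, 1 ≤ n → ∀ p, T n = some p → O n = some p) (n : ℕ) :
    burnSet f T n ⊆ burnSet f O n := by
  induction n with
  | zero => simp [burnSet]
  | succ n ih =>
    intro p hp
    rw [mem_burnSet_succ] at hp ⊢
    rcases hp with hp | hp | ⟨⟨q, hq, hpq⟩, hg⟩
    · exact Or.inl (h _ (by omega) _ hp)
    · exact Or.inr (Or.inl (ih hp))
    · exact Or.inr (Or.inr ⟨⟨q, ih hq, hpq⟩, hg⟩)

/-- If two sequences share their activators after time `M` and the second process, delayed by
`C`, dominates the first at time `M`, then it does so at all later times. -/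
lemma burnSet_subset_burnSet_add {f : ℕ → ℕ} {T O : ℕ → Option (ℤ × ℤ)} {M C : ℕ}
    (hf : MonotoneOn f (Set.Ici M)) (hTO : ∀ n, M < n → T n = O n)
    (hM : burnSet f O M ⊆ burnSet f T (M + C)) {n : ℕ} (hn : M ≤ n) :
    burnSet f O n ⊆ burnSet f T (n + C) := by
  induction n, hn using Nat.le_induction with
  | base => exact hM
  | succ n hn ih =>
    intro p hp
    rcases mem_burnSet_succ.1 hp with hp | hp | ⟨⟨q, hq, hpq⟩, hg⟩
    · exact burnSet_mono f T (Nat.le_add_right _ C)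
        (mem_burnSet_succ.2 (Or.inl ((hTO _ (by omega)).trans hp)))
    · exact burnSet_mono f T (by omega) (ih hp)
    · rw [Nat.add_right_comm]
      have hle : f (n + 1) ≤ f (n + C + 1) :=
        hf (Set.mem_Ici.2 (by omega)) (Set.mem_Ici.2 (by omega)) (by omega)
      exact mem_burnSet_succ.2 (Or.inr (Or.inr ⟨⟨q, ih hq, hpq⟩, inGrid_of_le hle hg⟩))

lemma card_le_of_forall_inGrid {f : ℕ → ℕ} {n : ℕ} {S : Finset (ℤ × ℤ)}
    (hS : ∀ p ∈ S, inGrid f n p) : S.card ≤ (2 * f n + 1) ^ 2 := by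
  have hsub : S ⊆ Finset.Icc (-(f n : ℤ)) (f n) ×ˢ Finset.Icc (-(f n : ℤ)) (f n) := by
    intro p hp
    obtain ⟨h₁, h₂⟩ := hS p hp
    simpa [Finset.mem_product] using And.intro (abs_le.1 h₁) (abs_le.1 h₂)
  refine (Finset.card_le_card hsub).trans (le_of_eq ?_)
  rw [Finset.card_product, Int.card_Icc, sq,
    show ((f n : ℤ) + 1 - -(f n : ℤ)).toNat = 2 * f n + 1 by omega]

lemma eventually_burnSet_inGrid {f : ℕ → ℕ} (hf : Tendsto f atTop atTop) {M : ℕ}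
    (hmono : MonotoneOn f (Set.Ici M)) {V : ℕ → Option (ℤ × ℤ)} (hV : IsActivator f V) :
    ∀ᶠ n in atTop, ∀ p ∈ burnSet f V n, inGrid f n p := by
  have hin : ∀ᶠ n in atTop, ∀ p ∈ burnSet f V M, inGrid f n p :=
    (Finset.eventually_all _).2 fun p _ => eventually_inGrid hf p
  filter_upwards [hin, eventually_ge_atTop M] with n hn hMn
  have key : ∀ m, M ≤ m → ∀ p ∈ burnSet f V m, p ∈ burnSet f V M ∨ inGrid f m p := by
    intro m hm
    induction m, hm using Nat.le_induction with
    | base => exact fun p hp => Or.inl hp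
    | succ m hm ih =>
      intro p hp
      rcases mem_burnSet_succ.1 hp with hp | hp | ⟨-, hg⟩
      · exact Or.inr (hV _ (by omega) _ hp)
      · exact (ih p hp).imp_right (inGrid_of_le
          (hmono (Set.mem_Ici.2 hm) (Set.mem_Ici.2 (by omega)) (Nat.le_succ m)))
      · exact Or.inr hg
  exact fun p hp => (key n hMn p hp).elim (hn p) id

lemma densitySeq_nonneg (f : ℕ → ℕ) (V : ℕ → Option (ℤ × ℤ)) (n : ℕ) :
    0 ≤ densitySeq f V n := by
  unfold densitySeq
  positivity

lemma densitySeq_le_one {f : ℕ → ℕ} {V : ℕ → Option (ℤ × ℤ)} {n : ℕ}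
    (h : ∀ p ∈ burnSet f V n, inGrid f n p) : densitySeq f V n ≤ 1 := by
  unfold densitySeq
  rw [div_le_one (by positivity)]
  exact_mod_cast card_le_of_forall_inGrid h

lemma densitySeq_le_of_subset {f : ℕ → ℕ} {T O : ℕ → Option (ℤ × ℤ)} {m n : ℕ}
    (hpos : 0 < f n) (hmn : f n ≤ f m) (h : burnSet f O n ⊆ burnSet f T m) :
    densitySeq f O n ≤ densitySeq f T m * ((f m : ℝ) / f n) ^ 2 := by
  have hpos' : (0 : ℝ) < f n := by exact_mod_cast hpos
  have hmn' : (f n : ℝ) ≤ f m := by exact_mod_cast hmn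
  have hcard : ((burnSet f O n).card : ℝ) ≤ (burnSet f T m).card := by
    exact_mod_cast Finset.card_le_card h
  have hratio : (2 * (f m : ℝ) + 1) / (2 * f n + 1) ≤ (f m : ℝ) / f n := by
    rw [div_le_div_iff₀ (by positivity) hpos']
    nlinarith
  calc densitySeq f O n ≤ (burnSet f T m).card / (2 * (f n : ℝ) + 1) ^ 2 := by
        unfold densitySeq; gcongr
    _ = densitySeq f T m * ((2 * (f m : ℝ) + 1) / (2 * f n + 1)) ^ 2 := by
        unfold densitySeq; field_simp
    _ ≤ densitySeq f T m * ((f m : ℝ) / f n) ^ 2 := by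
        have := densitySeq_nonneg f T m
        gcongr

/-- A sequence squeezed between `a` and a shift of `a` times a factor tending to `1` has the same
lower and upper limits as `a`. -/
lemma liminf_eq_and_limsup_eq_of_le_of_le_shift_mul {a b r : ℕ → ℝ} {C : ℕ}
    (ha : ∀ n, 0 ≤ a n) (hab : ∀ n, a n ≤ b n) (hb : ∀ᶠ n in atTop, b n ≤ 1)
    (hr : Tendsto r atTop (nhds 1)) (h : ∀ᶠ n in atTop, b n ≤ a (n + C) * r n) :
    liminf a atTop = liminf b atTop ∧ limsup a atTop = limsup b atTop := by
  have ha1 : ∀ᶠ n in atTop, a n ≤ 1 := hb.mono fun n hn => (hab n).trans hn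
  have hbn : ∀ n, 0 ≤ b n := fun n => (ha n).trans (hab n)
  have hshift : ∀ᶠ n in atTop, a (n + C) ≤ 1 := (tendsto_add_atTop_nat C).eventually ha1
  have bdd_above {u : ℕ → ℝ} {c : ℝ} (hu : ∀ᶠ n in atTop, u n ≤ c) :
      IsBoundedUnder (· ≤ ·) atTop u := isBoundedUnder_of_eventually_le hu
  have bdd_below {u : ℕ → ℝ} (hu : ∀ n, 0 ≤ u n) : IsBoundedUnder (· ≥ ·) atTop u :=
    isBoundedUnder_of_eventually_ge (Eventually.of_forall hu)
  have upper : ∀ ε > 0, ∀ᶠ n in atTop, b n ≤ a (n + C) + ε := by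
    intro ε hε
    filter_upwards [h, hshift, hr.eventually_le_const (show (1 : ℝ) < 1 + ε by linarith)]
      with n h₁ h₂ h₃
    nlinarith [ha (n + C)]
  have bdd_above_add (ε : ℝ) : IsBoundedUnder (· ≤ ·) atTop fun n => a (n + C) + ε :=
    bdd_above (hshift.mono fun n hn => add_le_add_left hn ε)
  have hle : a ≤ᶠ[atTop] b := Eventually.of_forall hab
  constructor
  · refine le_antisymm (liminf_le_liminf hle (bdd_below ha) (bdd_above hb).isCoboundedUnder_ge)
      (le_of_forall_pos_le_add fun ε hε => ?_)
    calc liminf b atTop ≤ liminf (fun n => a (n + C) + ε) atTop :=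
          liminf_le_liminf (upper ε hε) (bdd_below hbn) (bdd_above_add ε).isCoboundedUnder_ge
      _ = liminf (fun n => a (n + C)) atTop + ε :=
          liminf_add_const _ _ _ (bdd_above hshift).isCoboundedUnder_ge
            (bdd_below fun n => ha (n + C))
      _ = liminf a atTop + ε := by rw [liminf_nat_add a C]
  · refine le_antisymm (limsup_le_limsup hle (bdd_below ha).isCoboundedUnder_le (bdd_above hb))
      (le_of_forall_pos_le_add fun ε hε => ?_)
    calc limsup b atTop ≤ limsup (fun n => a (n + C) + ε) atTop :=
          limsup_le_limsup (upper ε hε) (bdd_below hbn).isCoboundedUnder_le (bdd_above_add ε)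
      _ = limsup (fun n => a (n + C)) atTop + ε :=
          limsup_add_const _ _ _ (bdd_above hshift)
            (bdd_below fun n => ha (n + C)).isCoboundedUnder_le
      _ = limsup a atTop + ε := by rw [limsup_nat_add a C]

lemma tendsto_atTop_of_strictMonoOn_Ici {f : ℕ → ℕ} {N : ℕ} (hf : StrictMonoOn f (Set.Ici N)) :
    Tendsto f atTop atTop := by
  have hshift : StrictMono fun n => f (n + N) := fun m n hmn =>
    hf (Set.mem_Ici.2 (by omega)) (Set.mem_Ici.2 (by omega)) (by omega)
  exact (tendsto_add_atTop_iff_nat N).1 hshift.tendsto_atTop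

/-- trimming the first `k` activators off an activator sequence (which
still activates some vertex after time `k`) does not change the lower and upper
burning densities. -/
theorem trimmed_sequence_same_density (f : ℕ → ℕ) (hcg : ControlledGrowth f)
    (k : ℕ) (hk : 1 ≤ k) (O T : ℕ → Option (ℤ × ℤ))
    (hO : IsActivator f O)
    (hOne : ∃ i, k < i ∧ O i ≠ none)
    (hT1 : ∀ n, 1 ≤ n → n ≤ k → T n = none)
    (hT2 : ∀ n, k < n → T n = O n) :
    lowerDensity f T = lowerDensity f O ∧ upperDensity f T = upperDensity f O := by
  obtain ⟨hgrow, hratio, -⟩ := hcg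
  obtain ⟨N, hN⟩ := eventually_atTop.1 hgrow
  have hstrict : StrictMonoOn f (Set.Ici N) :=
    strictMonoOn_of_lt_succ Set.ordConnected_Ici fun n _ hn _ => hN n hn
  have hf : Tendsto f atTop atTop := tendsto_atTop_of_strictMonoOn_Ici hstrict
  have hTO : ∀ n, 1 ≤ n → ∀ p, T n = some p → O n = some p := by
    intro n hn p hp
    rcases le_or_gt n k with h | h
    · simp [hT1 n hn h] at hp
    · rw [← hT2 n h, hp]
  obtain ⟨i, hki, hi⟩ := hOne
  obtain ⟨v, hv⟩ := Option.ne_none_iff_exists'.1 hi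
  have hvT : ∃ m, v ∈ burnSet f T m := by
    obtain ⟨j, rfl⟩ := Nat.exists_eq_add_one_of_ne_zero (show i ≠ 0 by omega)
    exact ⟨j + 1, mem_burnSet_succ.2 (Or.inl ((hT2 _ hki).trans hv))⟩
  set M := max N k
  have hmono : MonotoneOn f (Set.Ici M) :=
    hstrict.monotoneOn.mono (Set.Ici_subset_Ici.2 (le_max_left N k))
  obtain ⟨C, hC⟩ := exists_subset_burnSet hf hvT (burnSet f O M)
  have hC' : burnSet f O M ⊆ burnSet f T (M + C) :=
    hC.trans (burnSet_mono f T (Nat.le_add_left C M))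
  have hr : Tendsto (fun n => ((f (n + C) : ℝ) / f n) ^ 2) atTop (nhds 1) := by
    simpa using (hratio (fun _ => C)
      (isLittleO_const_left.2 (Or.inr (tendsto_norm_atTop_atTop.comp
        tendsto_natCast_atTop_atTop)))).pow 2
  refine liminf_eq_and_limsup_eq_of_le_of_le_shift_mul (C := C) (densitySeq_nonneg f T)
    (fun n => ?_) ((eventually_burnSet_inGrid hf hmono hO).mono fun n => densitySeq_le_one) hr ?_
  · unfold densitySeq
    gcongr
    exact burnSet_subset_of_forall hTO n
  · filter_upwards [eventually_ge_atTop M, hf.eventually_gt_atTop 0] with n hn hpos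
    exact densitySeq_le_of_subset hpos
      (hmono (Set.mem_Ici.2 hn) (Set.mem_Ici.2 (by omega)) (by omega))
      (burnSet_subset_burnSet_add hmono
        (fun m hm => hT2 m ((le_max_right N k).trans_lt hm)) hC' hn)
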